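/- arXiv:2005.00148 — 2 statements merged into one kernel-verified Lean document; each statement's English description precedes it below -/
import Mathlib

section
/- Let N, n, t ∈ ℕ with 1 ≤ N < t ≤ n − N, and let c : [0,1] → M₂(ℂ) satisfy c(0) = I₂, c(1) = the 2×2 swap matrix [[0,1],[1,0]], and c(θ) unitary for every θ. Let ξ_{N+1}, …, ξ_{t−1} ∈ [0,1] satisfy ξ_s = 0 for every s with t − N + 1 ≤ s ≤ t − 1. Then U[γⁿ_{1,n}]^N · (∏_{k=N}^{t−2} uⁿ_{k,n}(ξ_{k+1})) · U[σⁿ_{t−1,n}] = U[γⁿ_{1,t−1}]^N · (∏_{k=N}^{t−2} uⁿ_{k,t−1}(ξ_{k+1})) · U[γⁿ_{t,n}]^N, where the products are taken in increasing order of k and empty products equal Iₙ. -/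
/-- Given a path `c : [0,1] → M₂(ℂ)`, the matrix `u_{(i j)}(θ) ∈ Mₙ(ℂ)` agreeing with
the identity except that its `(i,i)`, `(i,j)`, `(j,i)`, `(j,j)` entries are the entries
of `c θ`.  (For `i = j` it is the identity matrix `Iₙ`.) -/
def uSwap {n : ℕ} (c : ℝ → Matrix (Fin 2) (Fin 2) ℂ) (i j : Fin n) (θ : ℝ) :
    Matrix (Fin n) (Fin n) ℂ :=
  if i = j then 1 else
    Matrix.of fun p q =>
      if p = i ∧ q = i then c θ 0 0
      else if p = i ∧ q = j then c θ 0 1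
      else if p = j ∧ q = i then c θ 1 0
      else if p = j ∧ q = j then c θ 1 1
      else if p = q then 1 else 0

/-- `uⁿ_{j,k}(θ) := u_{(j-N+1, k-N+1)}(θ) · u_{(j-N+2, k-N+2)}(θ) ⋯ u_{(j,k)}(θ)`
(`N` factors, in this order; all indices 1-based). -/
noncomputable def uNN (n N : ℕ) (c : ℝ → Matrix (Fin 2) (Fin 2) ℂ) (j k : ℕ)
    (hN : 1 ≤ N) (hj : N ≤ j) (hjk : j ≤ k) (hk : k ≤ n) (θ : ℝ) :
    Matrix (Fin n) (Fin n) ℂ :=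
  (List.ofFn fun s : Fin N =>
    uSwap c (⟨j - N + (s : ℕ), by have := s.2; omega⟩ : Fin n)
      (⟨k - N + (s : ℕ), by have := s.2; omega⟩ : Fin n) θ).prod

/-- `σⁿ_{j,k} := (j-N+1 k-N+1)(j-N+2 k-N+2)⋯(j k)`, a product of `N` transpositions
of `{1,…,n}` (1-based indices). -/
def sigmaNN (n N j k : ℕ) (hN : 1 ≤ N) (hj : N ≤ j) (hjk : j ≤ k) (hk : k ≤ n) :
    Equiv.Perm (Fin n) :=
  (List.ofFn fun s : Fin N =>
    Equiv.swap (⟨j - N + (s : ℕ), by have := s.2; omega⟩ : Fin n)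
      (⟨k - N + (s : ℕ), by have := s.2; omega⟩ : Fin n)).prod

/-- The permutation matrix `U[π]`, with `(p,q)`-entry equal to `1` if `p = π q`
and `0` otherwise. -/
def permMat {n : ℕ} (π : Equiv.Perm (Fin n)) : Matrix (Fin n) (Fin n) ℂ :=
  Matrix.of fun p q => if p = π q then 1 else 0

/-- `γ` is the cyclic permutation `(j j+1 ⋯ k)` of `{1,…,n}` (1-based indices):
`γ(p) = p + 1` for `j ≤ p < k`, `γ(k) = j`, and `γ(p) = p` for all other `p`. -/
def IsCycleSpec (n j k : ℕ) (γ : Equiv.Perm (Fin n)) : Prop :=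
  (∀ p : Fin n, j ≤ (p : ℕ) + 1 → (p : ℕ) + 1 < k → (γ p : ℕ) = (p : ℕ) + 1) ∧
  (∀ p : Fin n, (p : ℕ) + 1 = k → (γ p : ℕ) = j - 1) ∧
  (∀ p : Fin n, ((p : ℕ) + 1 < j ∨ k < (p : ℕ) + 1) → γ p = p)

theorem permMat_mul {n : ℕ} (π ρ : Equiv.Perm (Fin n)) :
    permMat (π * ρ) = permMat π * permMat ρ := by
  ext p q
  simp [permMat, Matrix.mul_apply]
  congr

theorem permMat_pow {n : ℕ} (π : Equiv.Perm (Fin n)) (k : ℕ) :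
    permMat (π ^ k) = permMat π ^ k := by
  induction k with
  | zero =>
    ext p q
    simp [permMat, Matrix.one_apply]
  | succ k ih => rw [pow_succ, pow_succ, permMat_mul, ih]

theorem uSwap_eq_one {n : ℕ} {c : ℝ → Matrix (Fin 2) (Fin 2) ℂ} {θ : ℝ} (hc : c θ = 1)
    (i j : Fin n) : uSwap c i j θ = 1 := by
  unfold uSwap
  split_ifs with hij
  · rfl
  · ext p q
    simp only [Matrix.of_apply, hc, Matrix.one_apply]
    grind

theorem semiconjBy_permMat_uSwap {n : ℕ} (c : ℝ → Matrix (Fin 2) (Fin 2) ℂ) (θ : ℝ)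
    (π : Equiv.Perm (Fin n)) {i j i' j' : Fin n} (hi : π i = i') (hj : π j = j') :
    SemiconjBy (permMat π) (uSwap c i j θ) (uSwap c i' j' θ) := by
  subst hi hj
  have left (A : Matrix (Fin n) (Fin n) ℂ) (p q) : (permMat π * A) (π p) q = A p q := by
    simp [permMat, Matrix.mul_apply]
  have right (A : Matrix (Fin n) (Fin n) ℂ) (p q) : (A * permMat π) p q = A p (π q) := by
    simp [permMat, Matrix.mul_apply]
  ext p q
  obtain ⟨p, rfl⟩ := π.surjective p
  rw [left, right]
  by_cases hij : i = j
  · simp [uSwap, hij, Matrix.one_apply]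
  · simp [uSwap, hij]

theorem SemiconjBy.list_prod_ofFn {M : Type*} [Monoid M] {a : M} {k : ℕ} {f g : Fin k → M}
    (h : ∀ s, SemiconjBy a (f s) (g s)) :
    SemiconjBy a (List.ofFn f).prod (List.ofFn g).prod := by
  induction k with
  | zero => simp
  | succ k ih =>
    rw [List.ofFn_succ, List.ofFn_succ, List.prod_cons, List.prod_cons]
    exact (h 0).mul_right (ih fun s => h s.succ)

theorem prod_ofFn_swap_apply_of_ne {α : Type*} [DecidableEq α] {k : ℕ} (a b : Fin k → α) {x : α}
    (ha : ∀ s, x ≠ a s) (hb : ∀ s, x ≠ b s) :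
    (List.ofFn fun s => Equiv.swap (a s) (b s)).prod x = x := by
  induction k with
  | zero => simp
  | succ k ih =>
    rw [List.ofFn_succ, List.prod_cons, Equiv.Perm.mul_apply,
      ih (fun s => a s.succ) (fun s => b s.succ) (fun s => ha _) fun s => hb _,
      Equiv.swap_apply_of_ne_of_ne (ha 0) (hb 0)]

theorem prod_ofFn_swap_apply {α : Type*} [DecidableEq α] {k : ℕ} (a b : Fin k → α)
    (ha : Function.Injective a) (hb : Function.Injective b) (hab : ∀ s r, a s ≠ b r) (r : Fin k) :
    (List.ofFn fun s => Equiv.swap (a s) (b s)).prod (a r) = b r ∧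
      (List.ofFn fun s => Equiv.swap (a s) (b s)).prod (b r) = a r := by
  induction k with
  | zero => exact r.elim0
  | succ k ih =>
    simp only [List.ofFn_succ, List.prod_cons, Equiv.Perm.mul_apply]
    cases r using Fin.cases with
    | zero =>
      rw [prod_ofFn_swap_apply_of_ne _ _
          (fun s h => (Fin.succ_ne_zero s).symm (ha h)) fun s => hab _ _,
        prod_ofFn_swap_apply_of_ne _ _ (fun s => (hab _ _).symm)
          fun s h => (Fin.succ_ne_zero s).symm (hb h)]
      simp
    | succ r =>
      obtain ⟨h₁, h₂⟩ := ih (fun s => a s.succ) (fun s => b s.succ)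
        (ha.comp (Fin.succ_injective k)) (hb.comp (Fin.succ_injective k)) (fun s r => hab _ _) r
      rw [h₁, h₂, Equiv.swap_apply_of_ne_of_ne (hab _ _).symm (hb.ne (Fin.succ_ne_zero r)),
        Equiv.swap_apply_of_ne_of_ne (ha.ne (Fin.succ_ne_zero r)) (hab _ _)]
      exact ⟨rfl, rfl⟩

theorem sigmaNN_apply_val (n N j k : ℕ) (hN : 1 ≤ N) (hj : N ≤ j) (hjk : j ≤ k) (hk : k ≤ n)
    (hlt : j + N ≤ k) (p : Fin n) :
    (sigmaNN n N j k hN hj hjk hk p : ℕ) =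
      if j - N ≤ (p : ℕ) ∧ (p : ℕ) < j then (p : ℕ) + (k - j)
      else if k - N ≤ (p : ℕ) ∧ (p : ℕ) < k then (p : ℕ) - (k - j)
      else p := by
  have key := prod_ofFn_swap_apply (k := N)
    (fun s => (⟨j - N + (s : ℕ), by have := s.2; omega⟩ : Fin n))
    (fun s => (⟨k - N + (s : ℕ), by have := s.2; omega⟩ : Fin n))
    (fun s r h => by simpa [Fin.ext_iff] using h)
    (fun s r h => by simpa [Fin.ext_iff] using h)
    (fun s r h => by
      have := s.2
      simp only [Fin.mk.injEq] at h
      omega)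
  unfold sigmaNN
  split_ifs with h₁ h₂
  · have h := (key ⟨p - (j - N), by omega⟩).1
    have e : (⟨j - N + (p - (j - N)), by omega⟩ : Fin n) = p := by ext; simp; omega
    simp only [e] at h
    rw [h]
    simp only
    omega
  · have h := (key ⟨p - (k - N), by omega⟩).2
    have e : (⟨k - N + (p - (k - N)), by omega⟩ : Fin n) = p := by ext; simp; omega
    simp only [e] at h
    rw [h]
    simp only
    omega
  · rw [prod_ofFn_swap_apply_of_ne]
    all_goals
      intro s h
      have := s.2
      rw [Fin.ext_iff] at h
      simp only at h
      omega

theorem IsCycleSpec.pow_apply_val {n j k : ℕ} {γ : Equiv.Perm (Fin n)} (h : IsCycleSpec n j k γ)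
    (hj : 1 ≤ j) (r : ℕ) (hr : j + r ≤ k + 1) (p : Fin n) :
    ((γ ^ r) p : ℕ) =
      if (p : ℕ) + 1 < j ∨ k < (p : ℕ) + 1 then (p : ℕ)
      else if (p : ℕ) + r < k then (p : ℕ) + r
      else (p : ℕ) + r + j - (k + 1) := by
  induction r with
  | zero =>
    simp only [pow_zero, Equiv.Perm.one_apply]
    split_ifs <;> omega
  | succ r ih =>
    specialize ih (by omega)
    rw [pow_succ', Equiv.Perm.mul_apply]
    obtain ⟨h₁, h₂, h₃⟩ := h
    specialize h₁ ((γ ^ r) p)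
    specialize h₂ ((γ ^ r) p)
    specialize h₃ ((γ ^ r) p)
    rw [Fin.ext_iff] at h₃
    split_ifs at ih ⊢ <;> omega

theorem IsCycleSpec.pow_mul_sigmaNN {n N m : ℕ} (hN : 1 ≤ N) (hNm : N ≤ m) (hmn : m + N < n)
    {γ₁ γ₂ γ₃ : Equiv.Perm (Fin n)} (h₁ : IsCycleSpec n 1 n γ₁) (h₂ : IsCycleSpec n 1 m γ₂)
    (h₃ : IsCycleSpec n (m + 1) n γ₃) :
    γ₁ ^ N * sigmaNN n N m n hN hNm (by omega) le_rfl = γ₂ ^ N * γ₃ ^ N := by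
  ext p
  have hp := p.2
  have hσ := sigmaNN_apply_val n N m n hN hNm (by omega) le_rfl (by omega) p
  have e₃ := h₃.pow_apply_val (by omega) N (by omega) p
  rw [Equiv.Perm.mul_apply, Equiv.Perm.mul_apply, h₁.pow_apply_val le_rfl N (by omega),
    h₂.pow_apply_val le_rfl N (by omega), hσ, e₃]
  split_ifs <;> omega

theorem uNN_eq_one {n N : ℕ} {c : ℝ → Matrix (Fin 2) (Fin 2) ℂ} {j k : ℕ}
    (hN : 1 ≤ N) (hj : N ≤ j) (hjk : j ≤ k) (hk : k ≤ n) {θ : ℝ} (hc : c θ = 1) :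
    uNN n N c j k hN hj hjk hk θ = 1 := by
  simp [uNN, uSwap_eq_one hc]

theorem semiconjBy_permMat_uNN {n N : ℕ} (c : ℝ → Matrix (Fin 2) (Fin 2) ℂ) {j k k' : ℕ}
    (hN : 1 ≤ N) (hj : N ≤ j) (hjk : j ≤ k) (hk : k ≤ n) (hjk' : j ≤ k') (hk' : k' ≤ n) (θ : ℝ)
    (π : Equiv.Perm (Fin n))
    (hπj : ∀ p : Fin n, j - N ≤ (p : ℕ) → (p : ℕ) < j → (π p : ℕ) = p)
    (hπk : ∀ p : Fin n, k - N ≤ (p : ℕ) → (p : ℕ) < k → (π p : ℕ) + k = p + k') :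
    SemiconjBy (permMat π) (uNN n N c j k hN hj hjk hk θ) (uNN n N c j k' hN hj hjk' hk' θ) := by
  refine SemiconjBy.list_prod_ofFn fun s => semiconjBy_permMat_uSwap c θ π ?_ ?_
  · have := s.2
    exact Fin.ext (hπj _ (by simp) (by simp only; omega))
  · have := s.2
    have := hπk ⟨k - N + (s : ℕ), by omega⟩ (by simp) (by simp only; omega)
    ext
    simp only at this ⊢
    omega

theorem stmt_14 (N n t : ℕ) (hN : 1 ≤ N) (hNt : N < t) (htn : t ≤ n - N)
    (c : ℝ → Matrix (Fin 2) (Fin 2) ℂ)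
    (hc0 : c 0 = 1) (hc1 : c 1 = !![0, 1; 1, 0])
    (hcU : ∀ θ : ℝ, 0 ≤ θ → θ ≤ 1 → c θ ∈ Matrix.unitaryGroup (Fin 2) ℂ)
    (ξ : ℕ → ℝ)
    (hξmem : ∀ s, N + 1 ≤ s → s ≤ t - 1 → 0 ≤ ξ s ∧ ξ s ≤ 1)
    (hξ0 : ∀ s, t - N + 1 ≤ s → s ≤ t - 1 → ξ s = 0)
    (γ1n γ1t γtn : Equiv.Perm (Fin n))
    (hγ1n : IsCycleSpec n 1 n γ1n)
    (hγ1t : IsCycleSpec n 1 (t - 1) γ1t)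
    (hγtn : IsCycleSpec n t n γtn) :
    permMat γ1n ^ N *
        (List.ofFn fun s : Fin (t - 1 - N) =>
          uNN n N c (N + (s : ℕ)) n hN (by omega) (by have := s.2; omega) le_rfl
            (ξ (N + (s : ℕ) + 1))).prod *
        permMat (sigmaNN n N (t - 1) n hN (by omega) (by omega) le_rfl) =
      permMat γ1t ^ N *
        (List.ofFn fun s : Fin (t - 1 - N) =>
          uNN n N c (N + (s : ℕ)) (t - 1) hN (by omega) (by have := s.2; omega)
            (by omega) (ξ (N + (s : ℕ) + 1))).prod *
        permMat γtn ^ N := by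
  obtain ⟨m, rfl⟩ : ∃ m, t = m + 1 := ⟨t - 1, by omega⟩
  have hσ : SemiconjBy (permMat (sigmaNN n N m n hN (by omega) (by omega) le_rfl))
      (List.ofFn fun s : Fin (m - N) =>
        uNN n N c (N + (s : ℕ)) m hN (by omega) (by have := s.2; omega)
          (by omega) (ξ (N + (s : ℕ) + 1))).prod
      (List.ofFn fun s : Fin (m - N) =>
        uNN n N c (N + (s : ℕ)) n hN (by omega) (by have := s.2; omega) le_rfl
          (ξ (N + (s : ℕ) + 1))).prod := by
    refine SemiconjBy.list_prod_ofFn fun s => ?_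
    have hs := s.2
    by_cases hsm : N + (s : ℕ) + N ≤ m
    · refine semiconjBy_permMat_uNN c hN _ _ _ _ _ _ _ ?_ ?_ <;>
      · intro p h₁ h₂
        rw [sigmaNN_apply_val n N m n hN _ _ _ (by omega)]
        split_ifs <;> omega
    · have hc : c (ξ (N + (s : ℕ) + 1)) = 1 := by
        rw [hξ0 _ (by omega) (by omega), hc0]
      rw [uNN_eq_one _ _ _ _ hc, uNN_eq_one _ _ _ _ hc]
      exact SemiconjBy.one_right _
  have hγ : SemiconjBy (permMat (γtn ^ N))
      (List.ofFn fun s : Fin (m - N) =>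
        uNN n N c (N + (s : ℕ)) m hN (by omega) (by have := s.2; omega)
          (by omega) (ξ (N + (s : ℕ) + 1))).prod
      (List.ofFn fun s : Fin (m - N) =>
        uNN n N c (N + (s : ℕ)) m hN (by omega) (by have := s.2; omega)
          (by omega) (ξ (N + (s : ℕ) + 1))).prod := by
    refine SemiconjBy.list_prod_ofFn fun s => ?_
    have hs := s.2
    refine semiconjBy_permMat_uNN c hN _ _ _ _ _ _ _ ?_ ?_ <;>
    · intro p h₁ h₂
      rw [hγtn.pow_apply_val (by omega) N (by omega), if_pos (by omega)]
  simp only [Nat.add_sub_cancel] at hγ1t hξ0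
  change _ * (List.ofFn fun s : Fin (m - N) => _).prod * permMat (sigmaNN n N m n hN _ _ le_rfl) =
    _ * (List.ofFn fun s : Fin (m - N) => uNN n N c (N + (s : ℕ)) m hN _ _ _ _).prod * _
  rw [mul_assoc, ← hσ.eq, ← permMat_pow, ← permMat_pow, ← permMat_pow, mul_assoc, ← hγ.eq,
    ← mul_assoc, ← mul_assoc, ← permMat_mul, ← permMat_mul,
    IsCycleSpec.pow_mul_sigmaNN hN (by omega) (by omega) hγ1n hγ1t hγtn]
end

section
/- Let N ≥ 1 and let c : [0,1] → M₂(ℂ) satisfy c(0) = I₂, c(1) = the 2×2 swap matrix [[0,1],[1,0]], and c(θ) unitary for every θ. Let n > N and let ξ = (ξ_1,…,ξ_n) ∈ [0,1]ⁿ satisfy: ξ_1 = 1; ξ_s = 0 for n − N + 1 ≤ s ≤ n; and among any N consecutive entries of ξ at most one is nonzero. Let 1 = k_1 < k_2 < ⋯ < k_m ≤ n be indices with ξ_{k_j} = 1 for each 1 ≤ j ≤ m, and set k_{m+1} := n + 1. Then Wₙ(ξ_1,…,ξ_n) equals the block-diagonal matrix diag(W_{k_2−k_1}(ξ_{k_1},…,ξ_{k_2−1}),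 W_{k_3−k_2}(ξ_{k_2},…,ξ_{k_3−1}), …, W_{k_{m+1}−k_m}(ξ_{k_m},…,ξ_{k_{m+1}−1})). -/
/-- For `n > N`, `Wₙ(ζ₁,…,ζₙ) := U[γⁿ_{1,n}]^N · ∏_{k=N}^{n-1} uⁿ_{k,n}(ζ_{k+1})`
(product in increasing order of `k`; here `γⁿ_{1,n}` is the full cycle `(1 2 ⋯ n)`,
realized by `finRotate n`), and for `n ≤ N`, `Wₙ := Iₙ`.  The vector `ζ` is encoded
as a function `ℕ → ℝ` via its 1-based entries. -/
noncomputable def Wfun (N : ℕ) (hN : 1 ≤ N) (c : ℝ → Matrix (Fin 2) (Fin 2) ℂ)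
    (n : ℕ) (ζ : ℕ → ℝ) : Matrix (Fin n) (Fin n) ℂ :=
  if _ : N < n then
    permMat (finRotate n) ^ N *
      (List.ofFn fun s : Fin (n - N) =>
        uNN n N c (N + (s : ℕ)) n hN (by omega) (by have := s.2; omega) le_rfl
          (ζ (N + (s : ℕ) + 1))).prod
  else 1

/-- The operator on sequences that mixes the windows `[a, a + w)` and `[b, b + w)`
entrywise through the `2 × 2` matrix `c θ` (meaningful for `a + w ≤ b`). -/
def windowMix (c : ℝ → Matrix (Fin 2) (Fin 2) ℂ) (w a b : ℕ) (θ : ℝ) :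
    Function.End (ℕ → ℂ) := fun f p =>
  if a ≤ p ∧ p < a + w then c θ 0 0 * f p + c θ 0 1 * f (p + (b - a))
  else if b ≤ p ∧ p < b + w then c θ 1 0 * f (p - (b - a)) + c θ 1 1 * f p
  else f p

/-- The operator on sequences that rotates the window `[o, E)` forward by `r`. -/
def windowRot (r o E : ℕ) : Function.End (ℕ → ℂ) := fun f p =>
  if o + r ≤ p ∧ p < E then f (p - r)
  else if o ≤ p ∧ p < E then f (p + (E - o) - r)
  else f p

/-- The operator on sequences which acts on the window `[o, E)` as the matrix `W` does and
fixes all other entries. -/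
def blockOp (N : ℕ) (c : ℝ → Matrix (Fin 2) (Fin 2) ℂ) (ξ : ℕ → ℝ) (o E : ℕ) :
    Function.End (ℕ → ℂ) :=
  windowRot N o E *
    ((List.range' (o + N) (E - o - N)).map
      fun K => windowMix c N (K - N) (E - N) (ξ (K + 1))).prod

/-- The operator `φ` acts on the window `[o, o + n)` as the matrix `M` and fixes all other
entries. -/
def ActsAs {n : ℕ} (o : ℕ) (M : Matrix (Fin n) (Fin n) ℂ) (φ : Function.End (ℕ → ℂ)) : Prop :=
  ∀ f : ℕ → ℂ, (∀ p : Fin n, φ f (o + p) = M.mulVec (fun q => f (o + q)) p) ∧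
    ∀ p, p < o ∨ o + n ≤ p → φ f p = f p

lemma ActsAs.one {n o : ℕ} : ActsAs o (1 : Matrix (Fin n) (Fin n) ℂ) 1 := fun f =>
  ⟨fun p => by rw [Matrix.one_mulVec]; rfl, fun _ _ => rfl⟩

lemma ActsAs.mul {n o : ℕ} {M M' : Matrix (Fin n) (Fin n) ℂ} {φ φ' : Function.End (ℕ → ℂ)}
    (h : ActsAs o M φ) (h' : ActsAs o M' φ') : ActsAs o (M * M') (φ * φ') := fun f => by
  refine ⟨fun p => ?_, fun p hp => ?_⟩
  · rw [← Matrix.mulVec_mulVec]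
    refine ((h (φ' f)).1 p).trans ?_
    congr 2
    funext q
    exact (h' f).1 q
  · exact ((h (φ' f)).2 p hp).trans ((h' f).2 p hp)

lemma ActsAs.prod_ofFn {n o L : ℕ} {A : Fin L → Matrix (Fin n) (Fin n) ℂ}
    {B : Fin L → Function.End (ℕ → ℂ)} (h : ∀ i, ActsAs o (A i) (B i)) :
    ActsAs o (List.ofFn A).prod (List.ofFn B).prod := by
  induction L with
  | zero => simpa using ActsAs.one
  | succ L ih =>
    simp only [List.ofFn_succ, List.prod_cons]
    exact (h 0).mul (ih fun i => h i.succ)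

lemma ActsAs.congr_window {n o : ℕ} {M : Matrix (Fin n) (Fin n) ℂ} {φ : Function.End (ℕ → ℂ)}
    (h : ActsAs o M φ) {f g : ℕ → ℂ} (hfg : ∀ q, o ≤ q → q < o + n → f q = g q)
    {p : ℕ} (hp : o ≤ p) (hp' : p < o + n) : φ f p = φ g p := by
  have hf := (h f).1 ⟨p - o, by omega⟩
  have hg := (h g).1 ⟨p - o, by omega⟩
  simp only [Nat.add_sub_cancel' hp] at hf hg
  rw [hf, hg]
  congr 1
  funext q
  exact hfg _ (by omega) (by omega)

lemma ActsAs.apply_eq {n o : ℕ} {M : Matrix (Fin n) (Fin n) ℂ} {φ : Function.End (ℕ → ℂ)}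
    (h : ActsAs o M φ) (p q : Fin n) : M p q = φ (Pi.single (o + q) 1) (o + p) := by
  rw [(h _).1 p]
  have : (fun r : Fin n => (Pi.single (o + q) 1 : ℕ → ℂ) (o + r)) = Pi.single q 1 := by
    funext r
    simp [Pi.single_apply, Fin.ext_iff]
  rw [this]
  simp

lemma windowMix_zero {c : ℝ → Matrix (Fin 2) (Fin 2) ℂ} (hc0 : c 0 = 1) (w a b : ℕ) :
    windowMix c w a b 0 = 1 := by
  funext f p
  simp [windowMix, hc0, Function.End.one_def]

lemma windowMix_succ (c : ℝ → Matrix (Fin 2) (Fin 2) ℂ) (θ : ℝ) {w a b : ℕ}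
    (h : a + (w + 1) ≤ b) :
    windowMix c 1 a b θ * windowMix c w (a + 1) (b + 1) θ = windowMix c (w + 1) a b θ := by
  funext f p
  change windowMix c 1 a b θ (windowMix c w (a + 1) (b + 1) θ f) p = _
  simp only [windowMix]
  grind

lemma prod_windowMix (c : ℝ → Matrix (Fin 2) (Fin 2) ℂ) (θ : ℝ) {w a b : ℕ} (h : a + w ≤ b) :
    (List.ofFn fun s : Fin w => windowMix c 1 (a + s) (b + s) θ).prod = windowMix c w a b θ := by
  induction w generalizing a b with
  | zero =>
    funext f p
    have h1 : ¬ (a ≤ p ∧ p < a) := by omega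
    have h2 : ¬ (b ≤ p ∧ p < b) := by omega
    simp [windowMix, h1, h2, Function.End.one_def]
  | succ w ih =>
    rw [List.ofFn_succ, List.prod_cons, ← windowMix_succ c θ h, ← ih (by omega)]
    simp only [Fin.val_zero, Fin.val_succ, add_zero, add_assoc, add_comm (1 : ℕ)]

lemma uSwap_mulVec (c : ℝ → Matrix (Fin 2) (Fin 2) ℂ) (θ : ℝ) {n : ℕ} {i j : Fin n}
    (hij : i ≠ j) (g : Fin n → ℂ) (p : Fin n) :
    (uSwap c i j θ).mulVec g p =
      if p = i then c θ 0 0 * g i + c θ 0 1 * g j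
      else if p = j then c θ 1 0 * g i + c θ 1 1 * g j
      else g p := by
  simp only [Matrix.mulVec, dotProduct]
  split_ifs with hi hj
  · have h : ∀ q, uSwap c i j θ p q * g q =
        (if q = i then c θ 0 0 * g q else 0) + (if q = j then c θ 0 1 * g q else 0) := by
      intro q
      simp only [uSwap, hij, if_false, Matrix.of_apply]
      grind
    simp [h, Finset.sum_add_distrib]
  · have h : ∀ q, uSwap c i j θ p q * g q =
        (if q = i then c θ 1 0 * g q else 0) + (if q = j then c θ 1 1 * g q else 0) := by
      intro q
      simp only [uSwap, hij, if_false, Matrix.of_apply]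
      grind
    simp [h, Finset.sum_add_distrib]
  · simp [uSwap, hij, hi, hj]

lemma actsAs_uSwap (c : ℝ → Matrix (Fin 2) (Fin 2) ℂ) (θ : ℝ) {n : ℕ} (o : ℕ) {i j : Fin n}
    (hij : i < j) : ActsAs o (uSwap c i j θ) (windowMix c 1 (o + i) (o + j) θ) := fun f => by
  have hij' : (i : ℕ) < j := hij
  refine ⟨fun p => ?_, fun p hp => ?_⟩
  · simp only [uSwap_mulVec c θ hij.ne, windowMix, Fin.ext_iff]
    grind
  · have h1 : ¬ (o + (i : ℕ) ≤ p ∧ p < o + i + 1) := by omega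
    have h2 : ¬ (o + (j : ℕ) ≤ p ∧ p < o + j + 1) := by omega
    simp only [windowMix, h1, h2, if_false]

lemma actsAs_uNN {c : ℝ → Matrix (Fin 2) (Fin 2) ℂ} (hc0 : c 0 = 1) {n N : ℕ} (o : ℕ) {k : ℕ}
    (hN : 1 ≤ N) (hk : N ≤ k) (hkn : k < n) {θ : ℝ} (hθ : n < k + N → θ = 0) :
    ActsAs o (uNN n N c k n hN hk hkn.le le_rfl θ)
      (windowMix c N (o + k - N) (o + n - N) θ) := by
  have e : windowMix c N (o + k - N) (o + n - N) θ =
      (List.ofFn fun s : Fin N => windowMix c 1 (o + (k - N + s)) (o + (n - N + s)) θ).prod := by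
    by_cases h : n < k + N
    · simp [hθ h, windowMix_zero hc0]
    · rw [← prod_windowMix c θ (by omega)]
      simp only [← add_assoc, Nat.add_sub_assoc hk, Nat.add_sub_assoc (hk.trans hkn.le)]
  rw [e]
  refine ActsAs.prod_ofFn fun s => actsAs_uSwap c θ o ?_
  rw [Fin.lt_def]
  dsimp only
  omega

lemma val_finRotate_symm {n : ℕ} (p : Fin n) :
    (((finRotate n).symm p : Fin n) : ℕ) = if (p : ℕ) = 0 then n - 1 else p - 1 := by
  obtain ⟨n, rfl⟩ : ∃ l, n = l + 1 := ⟨n - 1, by have := p.2; omega⟩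
  obtain ⟨q, rfl⟩ := (finRotate (n + 1)).surjective p
  rw [Equiv.symm_apply_apply, coe_finRotate]
  split_ifs <;> simp_all

lemma permMat_mulVec {n : ℕ} (π : Equiv.Perm (Fin n)) (g : Fin n → ℂ) (p : Fin n) :
    (permMat π).mulVec g p = g (π.symm p) := by
  simp [Matrix.mulVec, dotProduct, permMat, ← Equiv.symm_apply_eq]

lemma windowRot_succ {r o E : ℕ} (h : o + r + 1 ≤ E) :
    windowRot r o E * windowRot 1 o E = windowRot (r + 1) o E := by
  funext f p
  change windowRot r o E (windowRot 1 o E f) p = _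
  simp only [windowRot]
  grind

lemma actsAs_finRotate_pow (n o : ℕ) {r : ℕ} (hr : r ≤ n) :
    ActsAs o (permMat (finRotate n) ^ r) (windowRot r o (o + n)) := by
  induction r with
  | zero =>
    have : windowRot 0 o (o + n) = 1 := by
      funext f p
      change _ = f p
      simp only [windowRot]
      grind
    rw [this, pow_zero]
    exact ActsAs.one
  | succ r ih =>
    rw [pow_succ, ← windowRot_succ (by omega)]
    refine (ih (by omega)).mul fun f => ⟨fun p => ?_, fun p hp => ?_⟩
    · rw [permMat_mulVec, val_finRotate_symm]
      simp only [windowRot]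
      have := p.2
      split_ifs <;> first | omega | (congr 1; omega)
    · simp only [windowRot]
      split_ifs <;> first | omega | rfl

lemma windowRot_self (r o : ℕ) : windowRot r o (o + r) = 1 := by
  funext f p
  change _ = f p
  simp only [windowRot]
  grind

lemma ofFn_add_eq_map_range' {α : Type*} (g : ℕ → α) (a L : ℕ) :
    (List.ofFn fun s : Fin L => g (a + s)) = (List.range' a L).map g := by
  apply List.ext_getElem <;> simp

lemma actsAs_Wfun {N : ℕ} (hN : 1 ≤ N) {c : ℝ → Matrix (Fin 2) (Fin 2) ℂ} (hc0 : c 0 = 1)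
    {n o : ℕ} (hn : N ≤ n) {ξ ζ : ℕ → ℝ} (hζ : ∀ s, 1 ≤ s → ζ s = ξ (o + s))
    (htail : ∀ K, K < o + n → o + n < K + N → ξ (K + 1) = 0) :
    ActsAs o (Wfun N hN c n ζ) (blockOp N c ξ o (o + n)) := by
  rcases hn.lt_or_eq with hlt | rfl
  · rw [Wfun, dif_pos hlt, blockOp, ← ofFn_add_eq_map_range', Nat.add_sub_cancel_left]
    refine (actsAs_finRotate_pow n o hn).mul (ActsAs.prod_ofFn fun s => ?_)
    have hs := s.2
    have e : ζ (N + s + 1) = ξ (o + N + s + 1) := by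
      rw [hζ _ (by omega)]
      congr 1
      omega
    rw [e]
    have := actsAs_uNN hc0 o hN (k := N + s) (n := n) (by omega) (by omega)
      (θ := ξ (o + N + s + 1)) (fun h => htail _ (by omega) (by omega))
    simpa only [← add_assoc] using this
  · rw [Wfun, dif_neg (lt_irrefl _), blockOp, windowRot_self]
    simpa using ActsAs.one

lemma prod_map_mul_comm {M ι : Type*} [Monoid M] {x y : ι → M} {S : M} {l : List ι}
    (h : ∀ i ∈ l, x i * S = S * y i) : (l.map x).prod * S = S * (l.map y).prod := by
  induction l with
  | nil => simp
  | cons i l ih =>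
    simp only [List.map_cons, List.prod_cons]
    rw [mul_assoc, ih fun j hj => h j (by simp [hj]), ← mul_assoc, h i (by simp), mul_assoc]

lemma windowMix_mul_swap {c : ℝ → Matrix (Fin 2) (Fin 2) ℂ} (hc1 : c 1 = !![0, 1; 1, 0])
    (θ : ℝ) {N a m b : ℕ} (ham : a + N ≤ m) (hmb : m + N ≤ b) :
    windowMix c N a b θ * windowMix c N m b 1 = windowMix c N m b 1 * windowMix c N a m θ := by
  funext f p
  change windowMix c N a b θ (windowMix c N m b 1 f) p =
    windowMix c N m b 1 (windowMix c N a m θ f) p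
  simp only [windowMix, hc1, Matrix.of_apply, Matrix.cons_val', Matrix.cons_val_zero,
    Matrix.cons_val_one, Matrix.cons_val_fin_one, zero_mul, one_mul, zero_add, add_zero]
  grind

lemma windowMix_mul_windowRot (c : ℝ → Matrix (Fin 2) (Fin 2) ℂ) (θ : ℝ) {N r a b M E : ℕ}
    (hab : a + N ≤ b) (hbM : b + N ≤ M) (hME : M + r ≤ E) :
    windowMix c N a b θ * windowRot r M E = windowRot r M E * windowMix c N a b θ := by
  funext f p
  change windowMix c N a b θ (windowRot r M E f) p = windowRot r M E (windowMix c N a b θ f) p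
  simp only [windowMix, windowRot]
  grind

lemma windowRot_mul_swap {c : ℝ → Matrix (Fin 2) (Fin 2) ℂ} (hc1 : c 1 = !![0, 1; 1, 0])
    {N o M E : ℕ} (hoM : o + N ≤ M) (hME : M + N ≤ E) :
    windowRot N o E * windowMix c N (M - N) (E - N) 1 = windowRot N o M * windowRot N M E := by
  funext f p
  change windowRot N o E (windowMix c N (M - N) (E - N) 1 f) p =
    windowRot N o M (windowRot N M E f) p
  simp only [windowMix, windowRot, hc1, Matrix.of_apply, Matrix.cons_val', Matrix.cons_val_zero,
    Matrix.cons_val_one, Matrix.cons_val_fin_one, zero_mul, one_mul, zero_add, add_zero]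
  grind

/-- Splitting a window at an index where the parameter is `1`. -/
lemma blockOp_split {N : ℕ} (hN : 1 ≤ N) {c : ℝ → Matrix (Fin 2) (Fin 2) ℂ} (hc0 : c 0 = 1)
    (hc1 : c 1 = !![0, 1; 1, 0]) {ξ : ℕ → ℝ} {o M E : ℕ} (hoM : o + N ≤ M) (hME : M + N ≤ E)
    (hM : ξ (M + 1) = 1) (hbefore : ∀ K, o ≤ K → K < M → M < K + N → ξ (K + 1) = 0)
    (hafter : ∀ K, M < K → K < M + N → ξ (K + 1) = 0) :
    blockOp N c ξ o E = blockOp N c ξ o M * blockOp N c ξ M E := by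
  have hl : List.range' (o + N) (E - o - N) =
      List.range' (o + N) (M - o - N) ++
        (M :: (List.range' (M + 1) (N - 1) ++ List.range' (M + N) (E - M - N))) := by
    have h1 : List.range' (M + 1) (N - 1) ++ List.range' (M + N) (E - M - N) =
        List.range' (M + 1) (E - M - 1) := by
      have := List.range'_append_1 (s := M + 1) (m := N - 1) (n := E - M - N)
      rwa [show M + 1 + (N - 1) = M + N by omega,
        show N - 1 + (E - M - N) = E - M - 1 by omega] at this
    have h2 := List.range'_append_1 (s := o + N) (m := M - o - N) (n := E - M - 1 + 1)
    rw [show o + N + (M - o - N) = M by omega,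
      show M - o - N + (E - M - 1 + 1) = E - o - N by omega, List.range'_succ] at h2
    rw [h1, h2]
  have hmid : ((List.range' (M + 1) (N - 1)).map
      fun K => windowMix c N (K - N) (E - N) (ξ (K + 1))).prod = 1 := by
    refine List.prod_eq_one fun x hx => ?_
    obtain ⟨K, hK, rfl⟩ := List.mem_map.1 hx
    rw [List.mem_range'_1] at hK
    rw [hafter K (by omega) (by omega), windowMix_zero hc0]
  have hA := prod_map_mul_comm (l := List.range' (o + N) (M - o - N))
    (x := fun K => windowMix c N (K - N) (E - N) (ξ (K + 1)))
    (y := fun K => windowMix c N (K - N) (M - N) (ξ (K + 1)))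
    (S := windowMix c N (M - N) (E - N) 1) fun K hK => by
      rw [List.mem_range'_1] at hK
      by_cases h : M < K + N
      · simp [hbefore K (by omega) (by omega) h, windowMix_zero hc0]
      · exact windowMix_mul_swap hc1 _ (by omega) (by omega)
  have hR := prod_map_mul_comm (l := List.range' (o + N) (M - o - N))
    (x := fun K => windowMix c N (K - N) (M - N) (ξ (K + 1)))
    (y := fun K => windowMix c N (K - N) (M - N) (ξ (K + 1)))
    (S := windowRot N M E) fun K hK => by
      rw [List.mem_range'_1] at hK
      by_cases h : M < K + N
      · simp [hbefore K (by omega) (by omega) h, windowMix_zero hc0]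
      · exact windowMix_mul_windowRot c _ (by omega) (by omega) hME
  simp only [blockOp]
  rw [hl]
  simp only [List.map_append, List.map_cons, List.prod_append, List.prod_cons, hmid, one_mul, hM]
  rw [← mul_assoc (List.prod _), hA, mul_assoc, ← mul_assoc (windowRot N o E),
    windowRot_mul_swap hc1 hoM hME]
  simp only [mul_assoc]
  rw [← mul_assoc (List.prod _) (windowRot N M E), hR]
  simp only [mul_assoc]

theorem stmt_15 (N : ℕ) (hN : 1 ≤ N) (c : ℝ → Matrix (Fin 2) (Fin 2) ℂ)
    (hc0 : c 0 = 1) (hc1 : c 1 = !![0, 1; 1, 0])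
    (hcU : ∀ θ : ℝ, 0 ≤ θ → θ ≤ 1 → c θ ∈ Matrix.unitaryGroup (Fin 2) ℂ)
    (n : ℕ) (hn : N < n) (ξ : ℕ → ℝ)
    (hξmem : ∀ s, 1 ≤ s → s ≤ n → 0 ≤ ξ s ∧ ξ s ≤ 1)
    (hξ1 : ξ 1 = 1)
    (hξtail : ∀ s, n - N + 1 ≤ s → s ≤ n → ξ s = 0)
    (hξsep : ∀ a b, 1 ≤ a → a < b → b ≤ n → b < a + N → ξ a ≠ 0 → ξ b = 0)
    (m : ℕ) (hm : 1 ≤ m) (k : ℕ → ℕ)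
    (hk1 : k 1 = 1)
    (hkmono : ∀ j, 1 ≤ j → j < m → k j < k (j + 1))
    (hkn : ∀ j, 1 ≤ j → j ≤ m → k j ≤ n)
    (hklast : k (m + 1) = n + 1)
    (hkone : ∀ j, 1 ≤ j → j ≤ m → ξ (k j) = 1) :
    (∀ (j : ℕ) (hj1 : 1 ≤ j) (hjm : j ≤ m) (p q : Fin n)
        (hp1 : k j ≤ (p : ℕ) + 1) (hp2 : (p : ℕ) + 1 < k (j + 1))
        (hq1 : k j ≤ (q : ℕ) + 1) (hq2 : (q : ℕ) + 1 < k (j + 1)),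
      Wfun N hN c n ξ p q =
        Wfun N hN c (k (j + 1) - k j) (fun i => ξ (k j + i - 1))
          ⟨(p : ℕ) + 1 - k j, by omega⟩ ⟨(q : ℕ) + 1 - k j, by omega⟩) ∧
    (∀ p q : Fin n,
      (¬ ∃ j, 1 ≤ j ∧ j ≤ m ∧ k j ≤ (p : ℕ) + 1 ∧ (p : ℕ) + 1 < k (j + 1) ∧
          k j ≤ (q : ℕ) + 1 ∧ (q : ℕ) + 1 < k (j + 1)) →
        Wfun N hN c n ξ p q = 0) := by
  have hkpos : ∀ j, 1 ≤ j → j ≤ m → 1 ≤ k j := by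
    intro j hj
    induction j, hj using Nat.le_induction with
    | base => intro _; omega
    | succ j hj ih =>
      intro hjm
      have := hkmono j hj (by omega)
      omega
  have hkE : ∀ j, 1 ≤ j → j ≤ m → k j + N ≤ n := by
    intro j hj hjm
    by_contra h
    have := hξtail (k j) (by omega) (hkn j hj hjm)
    rw [hkone j hj hjm] at this
    exact one_ne_zero this
  have hlen : ∀ j, 1 ≤ j → j ≤ m → k j + N ≤ k (j + 1) := by
    intro j hj hjm
    rcases hjm.lt_or_eq with h | rfl
    · by_contra hlt
      have := hξsep (k j) (k (j + 1)) (hkpos j hj hjm) (hkmono j hj h)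
        (hkn (j + 1) (by omega) h) (by omega) (by rw [hkone j hj hjm]; exact one_ne_zero)
      rw [hkone (j + 1) (by omega) h] at this
      exact one_ne_zero this
    · have := hkE j hj le_rfl
      omega
  have hbefore : ∀ j, 1 ≤ j → j ≤ m → ∀ K, K < k (j + 1) - 1 → k (j + 1) - 1 < K + N →
      ξ (K + 1) = 0 := by
    intro j hj hjm K h1 h2
    rcases hjm.lt_or_eq with h | rfl
    · by_contra hne
      have := hξsep (K + 1) (k (j + 1)) (by omega) (by omega) (hkn (j + 1) (by omega) h)
        (by omega) hne
      rw [hkone (j + 1) (by omega) h] at this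
      exact one_ne_zero this
    · exact hξtail (K + 1) (by omega) (by omega)
  have hacts : ∀ j (_ : 1 ≤ j) (_ : j ≤ m),
      ActsAs (k j - 1) (Wfun N hN c (k (j + 1) - k j) (fun i => ξ (k j + i - 1)))
        (blockOp N c ξ (k j - 1) (k (j + 1) - 1)) := by
    intro j hj hjm
    have h1 := hkpos j hj hjm
    have h2 := hlen j hj hjm
    have e : k (j + 1) - 1 = k j - 1 + (k (j + 1) - k j) := by omega
    rw [e]
    refine actsAs_Wfun hN hc0 (by omega) (fun s hs => ?_) fun K hK hK' =>
      hbefore j hj hjm K (by omega) (by omega)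
    congr 1
    omega
  have hfull : ActsAs 0 (Wfun N hN c n ξ) (blockOp N c ξ 0 n) := by
    have := actsAs_Wfun hN hc0 (o := 0) (n := n) (ξ := ξ) (ζ := ξ) hn.le
      (fun s _ => by rw [zero_add]) fun K hK hK' => hξtail (K + 1) (by omega) (by omega)
    rwa [zero_add] at this
  have hrestrict : ∀ d t, 1 ≤ t → t + d = m → ∀ j, t ≤ j → j ≤ m → ∀ f : ℕ → ℂ, ∀ p,
      k j - 1 ≤ p → p < k (j + 1) - 1 →
      blockOp N c ξ (k t - 1) n f p = blockOp N c ξ (k j - 1) (k (j + 1) - 1) f p := by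
    intro d
    induction d with
    | zero =>
      intro t ht htm j htj hjm f p _ _
      obtain rfl : t = j := by omega
      obtain rfl : t = m := by omega
      rw [hklast, Nat.add_sub_cancel]
    | succ d ih =>
      intro t ht htm j htj hjm f p hp hp'
      have h1 := hkpos t ht (by omega)
      have h2 := hlen t ht (by omega)
      have h3 := hkE (t + 1) (by omega) (by omega)
      have h4 : k (t + 1) - 1 + 1 = k (t + 1) := by omega
      have hone := hkone (t + 1) (by omega) (by omega)
      rw [blockOp_split hN hc0 hc1 (M := k (t + 1) - 1) (by omega) (by omega) (by rw [h4, hone])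
        (fun K _ => hbefore t ht (by omega) K)
        (fun K hK hK' => hξsep (k (t + 1)) (K + 1) (by omega) (by omega) (by omega) (by omega)
          (by rw [hone]; exact one_ne_zero))]
      change blockOp N c ξ (k t - 1) (k (t + 1) - 1) (blockOp N c ξ (k (t + 1) - 1) n f) p = _
      rcases htj.eq_or_lt with rfl | hlt
      · refine (hacts t ht hjm).congr_window (fun q hq hq' => ?_) hp (by omega)
        have h5 := actsAs_Wfun hN hc0 (o := k (t + 1) - 1) (n := n - (k (t + 1) - 1)) (ξ := ξ)
          (ζ := fun s => ξ (k (t + 1) - 1 + s)) (by omega)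
          (fun s _ => rfl) fun K hK hK' => hξtail (K + 1) (by omega) (by omega)
        rw [show k (t + 1) - 1 + (n - (k (t + 1) - 1)) = n by omega] at h5
        exact (h5 f).2 q (by omega)
      · have hmono : ∀ i, t + 1 ≤ i → i ≤ m → k (t + 1) ≤ k i := by
          intro i hi
          induction i, hi using Nat.le_induction with
          | base => intro _; rfl
          | succ i hi ih' =>
            intro him
            exact (ih' (by omega)).trans (hkmono i (by omega) (by omega)).le
        have h5 := hmono j hlt hjm
        rw [((hacts t ht (by omega)) _).2 p (by omega)]
        exact ih (t + 1) (by omega) (by omega) j hlt hjm f p hp hp'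
  have hentry : ∀ j, 1 ≤ j → j ≤ m → ∀ p q : Fin n, k j ≤ (p : ℕ) + 1 →
      (p : ℕ) + 1 < k (j + 1) → Wfun N hN c n ξ p q =
        blockOp N c ξ (k j - 1) (k (j + 1) - 1) (Pi.single (q : ℕ) 1) p := by
    intro j hj hjm p q hp hp'
    rw [hfull.apply_eq p q]
    have := hrestrict (m - 1) 1 le_rfl (by omega) j hj hjm (Pi.single (q : ℕ) 1) p (by omega)
      (by omega)
    rw [hk1] at this
    simpa only [zero_add] using this
  constructor
  · intro j hj hjm p q hp1 hp2 hq1 hq2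
    have h1 := hkpos j hj hjm
    rw [hentry j hj hjm p q hp1 hp2, (hacts j hj hjm).apply_eq]
    dsimp only
    rw [show k j - 1 + ((q : ℕ) + 1 - k j) = q by omega,
      show k j - 1 + ((p : ℕ) + 1 - k j) = p by omega]
  · intro p q hpq
    obtain ⟨j, hj, hjm, hp, hp'⟩ :
        ∃ j, 1 ≤ j ∧ j ≤ m ∧ k j ≤ (p : ℕ) + 1 ∧ (p : ℕ) + 1 < k (j + 1) := by
      by_contra hno
      have : ∀ j, 1 ≤ j → j ≤ m + 1 → k j ≤ (p : ℕ) + 1 := by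
        intro j hj
        induction j, hj using Nat.le_induction with
        | base => intro _; omega
        | succ j hj ih =>
          intro hjm
          by_contra hlt
          exact hno ⟨j, hj, by omega, ih (by omega), by omega⟩
      have := this (m + 1) (by omega) le_rfl
      omega
    have h1 := hkpos j hj hjm
    have h2 := hlen j hj hjm
    rw [hentry j hj hjm p q hp hp', (hacts j hj hjm).congr_window (g := 0)
      (fun r hr hr' => Pi.single_eq_of_ne (fun h => hpq
        ⟨j, hj, hjm, hp, hp', by omega, by omega⟩) _) (by omega) (by omega)]
    have := (hacts j hj hjm 0).1 ⟨p + 1 - k j, by omega⟩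
    rw [show k j - 1 + ((p : ℕ) + 1 - k j) = p by omega] at this
    rw [this]
    exact congrFun (Matrix.mulVec_zero _) _
end
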